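/- Let K be the attractor of an IFS of similitudes on a complete metric space with similarity dimension α, endowed with its natural fractal structure. Then the natural fractal structure is irreducible if and only if dim⁴(K) = dim³(K) = α. -/

import Mathlib

open scoped ENNReal

namespace IFSMoran

variable {X : Type*} [MetricSpace X]

/-- The map `f_i = f_{i1} o ... o f_{in}` associated to a word `i = i1...in`
(a list of indices). -/
def wMap {k : ℕ} (f : Fin k → X → X) : List (Fin k) → X → X
  | [] => id
  | i :: w => f i ∘ wMap f w

/-- The piece `A_i = f_i(K)` of the natural fractal structure. -/
def piece {k : ℕ} (f : Fin k → X → X) (K : Set X) (w : List (Fin k)) : Set X :=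
  wMap f w '' K

/-- The natural fractal structure (levels indexed by words) is irreducible:
no level admits a proper subcovering. -/
def Irred {k : ℕ} (f : Fin k → X → X) (K : Set X) : Prop :=
  ∀ w : List (Fin k),
    ¬ piece f K w ⊆ ⋃ v ∈ {v : List (Fin k) | v.length = w.length ∧ v ≠ w}, piece f K v

/-- `H³ₙˢ(K) = inf_{l ≥ n} ∑_{i ∈ Σˡ} diam (A_i) ^ s`. -/
noncomputable def H3n {k : ℕ} (f : Fin k → X → X) (K : Set X) (s : ℝ) (n : ℕ) : ℝ≥0∞ :=
  ⨅ (l : ℕ) (_ : n ≤ l),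
    ∑ w : Fin l → Fin k, EMetric.diam (piece f K (List.ofFn w)) ^ s

/-- `H³ˢ(K) = lim_n H³ₙˢ(K)`; the sequence is nondecreasing in `n`, so the limit
is the supremum. -/
noncomputable def H3 {k : ℕ} (f : Fin k → X → X) (K : Set X) (s : ℝ) : ℝ≥0∞ :=
  ⨆ n, H3n f K s n

/-- Fractal dimension III: `dim³(K) = inf {s ≥ 0 : H³ˢ(K) = 0}`. -/
noncomputable def dim3 {k : ℕ} (f : Fin k → X → X) (K : Set X) : ℝ :=
  sInf {s : ℝ | 0 ≤ s ∧ H3 f K s = 0}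

/-- `H⁴ₙˢ(K)`: infimum of `∑ diam (A_i) ^ s` over finite coverings of `K` by
pieces indexed by words of length `≥ n`. -/
noncomputable def H4n {k : ℕ} (f : Fin k → X → X) (K : Set X) (s : ℝ) (n : ℕ) : ℝ≥0∞ :=
  ⨅ (𝒜 : Finset (List (Fin k))) (_ : ∀ w ∈ 𝒜, n ≤ w.length)
      (_ : K ⊆ ⋃ w ∈ 𝒜, piece f K w),
    ∑ w ∈ 𝒜, EMetric.diam (piece f K w) ^ s

/-- `H⁴ˢ(K) = lim_n H⁴ₙˢ(K)`; the sequence is nondecreasing in `n`, so the limit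
is the supremum. -/
noncomputable def H4 {k : ℕ} (f : Fin k → X → X) (K : Set X) (s : ℝ) : ℝ≥0∞ :=
  ⨆ n, H4n f K s n

/-- Fractal dimension IV: `dim⁴(K) = inf {s ≥ 0 : H⁴ˢ(K) = 0}`. -/
noncomputable def dim4 {k : ℕ} (f : Fin k → X → X) (K : Set X) : ℝ :=
  sInf {s : ℝ | 0 ≤ s ∧ H4 f K s = 0}

/-- Interior of `A` relative to `K` (as a subset of the ambient space `X`). -/
def intK (K A : Set X) : Set X := K \ closure (K \ A)

/-- The level separation property: interiors (in `K`) of two pieces indexed by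
distinct words of the same length are disjoint (LSP1), and every piece has
nonempty interior in `K` (LSP2). -/
def LSP {k : ℕ} (f : Fin k → X → X) (K : Set X) : Prop :=
  (∀ v w : List (Fin k), v.length = w.length → v ≠ w →
      intK K (piece f K v) ∩ intK K (piece f K w) = ∅) ∧
  ∀ w : List (Fin k), (intK K (piece f K w)).Nonempty

/-- The natural fractal structure is a tiling: pieces indexed by distinct words
of the same length have disjoint interiors in `K`, and every piece is regularly
closed in `K`, i.e. `cl_K (int_K (A_i)) = A_i`. -/
def IsTiling {k : ℕ} (f : Fin k → X → X) (K : Set X) : Prop :=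
  (∀ v w : List (Fin k), v.length = w.length → v ≠ w →
      intK K (piece f K v) ∩ intK K (piece f K w) = ∅) ∧
  ∀ w : List (Fin k), closure (intK K (piece f K w)) ∩ K = piece f K w


open Filter Topology

section Words

variable {k : ℕ}

/-- The finite set of words of length `n`. -/
def words (k n : ℕ) : Finset (List (Fin k)) :=
  Finset.univ.image (List.ofFn : (Fin n → Fin k) → List (Fin k))

theorem mem_words {n : ℕ} {w : List (Fin k)} : w ∈ words k n ↔ w.length = n := by
  simp only [words, Finset.mem_image, Finset.mem_univ, true_and]
  constructor
  · rintro ⟨u, rfl⟩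
    simp
  · rintro rfl
    exact ⟨w.get, List.ofFn_get w⟩

theorem sum_words {M : Type*} [AddCommMonoid M] (n : ℕ) (g : List (Fin k) → M) :
    ∑ w ∈ words k n, g w = ∑ u : Fin n → Fin k, g (List.ofFn u) :=
  Finset.sum_image fun _ _ _ _ h => List.ofFn_injective h

/-- The multiplicative weight of a word. -/
def weight (p : Fin k → ℝ) (w : List (Fin k)) : ℝ := (w.map p).prod

theorem weight_nonneg {p : Fin k → ℝ} (hp : ∀ i, 0 ≤ p i) (w : List (Fin k)) :
    0 ≤ weight p w := by
  induction w with
  | nil => simp [weight]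
  | cons i w ih => simpa [weight] using mul_nonneg (hp i) ih

theorem weight_pos {p : Fin k → ℝ} (hp : ∀ i, 0 < p i) (w : List (Fin k)) :
    0 < weight p w := by
  induction w with
  | nil => simp [weight]
  | cons i w ih => simpa [weight] using mul_pos (hp i) ih

theorem weight_append (p : Fin k → ℝ) (v w : List (Fin k)) :
    weight p (v ++ w) = weight p v * weight p w := by
  simp [weight]

theorem weight_rpow {c : Fin k → ℝ} (hc : ∀ i, 0 ≤ c i) (s : ℝ) (w : List (Fin k)) :
    weight (fun i => c i ^ s) w = weight c w ^ s := by
  induction w with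
  | nil => simp [weight]
  | cons i w ih =>
    have h := Real.mul_rpow (hc i) (weight_nonneg hc w) (z := s)
    rw [← ih] at h
    simpa [weight] using h.symm

theorem sum_weight_words (p : Fin k → ℝ) (n : ℕ) :
    ∑ w ∈ words k n, weight p w = (∑ i, p i) ^ n := by
  rw [sum_words, Fintype.sum_pow]
  simp [weight, List.prod_ofFn]

/-- The words of length `n` extending `a` weigh at most as much as `a`
when the letters have total weight one. -/
theorem sum_weight_prefix_le {p : Fin k → ℝ} (hp : ∀ i, 0 ≤ p i) (hsum : ∑ i, p i = 1)
    (a : List (Fin k)) (n : ℕ) :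
    ∑ w ∈ words k n with a <+: w, weight p w ≤ weight p a := by
  have hsub : {w ∈ words k n | a <+: w} ⊆ (words k (n - a.length)).image (a ++ ·) := by
    intro w hw
    obtain ⟨hw, v, rfl⟩ := Finset.mem_filter.1 hw
    rw [mem_words, List.length_append] at hw
    exact Finset.mem_image_of_mem _ (mem_words.2 (by omega))
  calc _ ≤ ∑ w ∈ (words k (n - a.length)).image (a ++ ·), weight p w :=
        Finset.sum_le_sum_of_subset_of_nonneg hsub fun w _ _ => weight_nonneg hp w
    _ = weight p a := by
        rw [Finset.sum_image fun _ _ _ _ h => List.append_cancel_left h]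
        simp only [weight_append]
        rw [← Finset.mul_sum, sum_weight_words, hsum, one_pow, mul_one]

/-- A finite set of words containing a prefix of every word of length `n` has total weight
at least one when the letters have total weight one. -/
theorem one_le_sum_weight {p : Fin k → ℝ} (hp : ∀ i, 0 ≤ p i) (hsum : ∑ i, p i = 1)
    (𝒜 : Finset (List (Fin k))) (n : ℕ)
    (h : ∀ w : List (Fin k), w.length = n → ∃ a ∈ 𝒜, a <+: w) :
    1 ≤ ∑ a ∈ 𝒜, weight p a := by
  calc 1 = ∑ w ∈ words k n, weight p w := by rw [sum_weight_words, hsum, one_pow]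
    _ ≤ ∑ w ∈ words k n, ∑ a ∈ 𝒜, if a <+: w then weight p w else 0 := by
        refine Finset.sum_le_sum fun w hw => ?_
        obtain ⟨a, ha, haw⟩ := h w (mem_words.1 hw)
        refine le_of_eq_of_le (if_pos haw).symm (Finset.single_le_sum
          (f := fun a => if a <+: w then weight p w else 0) (fun b _ => ?_) ha)
        split_ifs
        exacts [weight_nonneg hp w, le_rfl]
    _ = ∑ a ∈ 𝒜, ∑ w ∈ words k n with a <+: w, weight p w := by
        rw [Finset.sum_comm]
        simp only [Finset.sum_filter]
    _ ≤ ∑ a ∈ 𝒜, weight p a :=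
        Finset.sum_le_sum fun a _ => sum_weight_prefix_le hp hsum a n

end Words

section Pieces

variable {Y : Type*} {k : ℕ} {f : Fin k → Y → Y} {K : Set Y}

theorem wMap_append (v w : List (Fin k)) : wMap f (v ++ w) = wMap f v ∘ wMap f w := by
  induction v with
  | nil => rfl
  | cons i v ih => simp [wMap, ih, Function.comp_assoc]

theorem piece_append (v w : List (Fin k)) :
    piece f K (v ++ w) = wMap f v '' piece f K w := by
  rw [piece, wMap_append, Set.image_comp, piece]

theorem exists_mem_piece (hK : K ⊆ ⋃ i, f i '' K) (n : ℕ) {x : Y} (hx : x ∈ K) :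
    ∃ w : List (Fin k), w.length = n ∧ x ∈ piece f K w := by
  induction n generalizing x with
  | zero => exact ⟨[], rfl, x, hx, rfl⟩
  | succ n ih =>
    obtain ⟨i, y, hy, rfl⟩ := Set.mem_iUnion.1 (hK hx)
    obtain ⟨w, hw, hyw⟩ := ih hy
    exact ⟨[i] ++ w, by simp [hw], by rw [piece_append]; exact ⟨y, hyw, rfl⟩⟩

theorem piece_subset (hK : ⋃ i, f i '' K ⊆ K) (w : List (Fin k)) : piece f K w ⊆ K := by
  induction w with
  | nil => simp [piece, wMap]
  | cons i w ih =>
    rw [← List.singleton_append, piece_append]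
    exact (Set.image_mono ih).trans ((Set.subset_iUnion (fun i => f i '' K) i).trans hK)

/-- Iterating a cover of `K` by pieces. -/
theorem exists_cover_pow {p : Fin k → ℝ} (hp : ∀ i, 0 ≤ p i) {B : Finset (List (Fin k))}
    (hB : ∀ w ∈ B, 1 ≤ w.length) (hcov : K ⊆ ⋃ w ∈ B, piece f K w) (m : ℕ) :
    ∃ 𝒜 : Finset (List (Fin k)), (∀ w ∈ 𝒜, m ≤ w.length) ∧ (K ⊆ ⋃ w ∈ 𝒜, piece f K w) ∧
      ∑ w ∈ 𝒜, weight p w ≤ (∑ w ∈ B, weight p w) ^ m := by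
  induction m with
  | zero => exact ⟨{[]}, by simp, by simp [piece, wMap], by simp [weight]⟩
  | succ m ih =>
    obtain ⟨𝒜, hlen, hA, hsum⟩ := ih
    refine ⟨(B ×ˢ 𝒜).image fun q => q.1 ++ q.2, ?_, ?_, ?_⟩
    · intro w hw
      obtain ⟨⟨v, a⟩, hva, rfl⟩ := Finset.mem_image.1 hw
      obtain ⟨hv, ha⟩ := Finset.mem_product.1 hva
      have := hB v hv
      have := hlen a ha
      simp only [List.length_append]
      omega
    · intro x hx
      obtain ⟨v, hv, y, hy, rfl⟩ := Set.mem_iUnion₂.1 (hcov hx)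
      obtain ⟨a, ha, hya⟩ := Set.mem_iUnion₂.1 (hA hy)
      refine Set.mem_iUnion₂.2 ⟨v ++ a,
        Finset.mem_image.2 ⟨(v, a), Finset.mk_mem_product hv ha, rfl⟩, ?_⟩
      rw [piece_append]
      exact Set.mem_image_of_mem _ hya
    · calc _ ≤ ∑ q ∈ B ×ˢ 𝒜, weight p (q.1 ++ q.2) :=
            Finset.sum_image_le_of_nonneg fun q _ => weight_nonneg hp _
        _ = (∑ w ∈ B, weight p w) * ∑ w ∈ 𝒜, weight p w := by
            simp only [weight_append]
            rw [Finset.sum_mul_sum, Finset.sum_product]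
        _ ≤ (∑ w ∈ B, weight p w) ^ (m + 1) := by
            rw [pow_succ']
            exact mul_le_mul_of_nonneg_left hsum
              (Finset.sum_nonneg fun w _ => weight_nonneg hp w)

/-- In an irreducible structure, a finite cover of `K` by pieces contains a prefix of
every sufficiently long word. -/
theorem Irred.exists_prefix (hirr : Irred f K) (hK : K = ⋃ i, f i '' K)
    {𝒜 : Finset (List (Fin k))} (hA : K ⊆ ⋃ w ∈ 𝒜, piece f K w) {w : List (Fin k)}
    (hw : ∀ a ∈ 𝒜, a.length ≤ w.length) : ∃ a ∈ 𝒜, a <+: w := by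
  by_contra! hno
  refine hirr w fun x hx => ?_
  obtain ⟨a, ha, y, hy, rfl⟩ := Set.mem_iUnion₂.1 (hA (piece_subset hK.ge w hx))
  obtain ⟨v, hv, hyv⟩ := exists_mem_piece hK.le (w.length - a.length) hy
  refine Set.mem_iUnion₂.2 ⟨a ++ v, ⟨?_, ?_⟩, ?_⟩
  · have := hw a ha
    simp only [List.length_append]
    omega
  · rintro rfl
    exact hno a ha (List.prefix_append a v)
  · rw [piece_append]
    exact Set.mem_image_of_mem _ hyv

end Pieces

section Dimensions

variable {k : ℕ} {f : Fin k → X → X} {K : Set X}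

theorem edist_wMap {c : Fin k → ℝ} (hc : ∀ i, 0 ≤ c i)
    (hf : ∀ i x y, dist (f i x) (f i y) = c i * dist x y) (w : List (Fin k)) (x y : X) :
    edist (wMap f w x) (wMap f w y) = ENNReal.ofReal (weight c w) * edist x y := by
  have h : dist (wMap f w x) (wMap f w y) = weight c w * dist x y := by
    induction w with
    | nil => simp [wMap, weight]
    | cons i w ih => simp [wMap, weight, hf] at ih ⊢; rw [ih, mul_assoc]
  rw [edist_dist, edist_dist, h, ENNReal.ofReal_mul (weight_nonneg hc w)]

theorem ediam_piece {c : Fin k → ℝ} (hc : ∀ i, 0 < c i)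
    (hf : ∀ i x y, dist (f i x) (f i y) = c i * dist x y) (w : List (Fin k)) :
    Metric.ediam (piece f K w) = ENNReal.ofReal (weight c w) * Metric.ediam K := by
  simp only [piece, Metric.ediam, iSup_image, edist_wMap (fun i => (hc i).le) hf,
    ENNReal.mul_iSup]

theorem ediam_piece_rpow {c : Fin k → ℝ} (hc : ∀ i, 0 < c i)
    (hf : ∀ i x y, dist (f i x) (f i y) = c i * dist x y) {s : ℝ} (hs : 0 ≤ s)
    (w : List (Fin k)) :
    Metric.ediam (piece f K w) ^ s =
      ENNReal.ofReal (weight (fun i => c i ^ s) w) * Metric.ediam K ^ s := by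
  rw [ediam_piece hc hf, ENNReal.mul_rpow_of_nonneg _ _ hs, weight_rpow fun i => (hc i).le,
    ENNReal.ofReal_rpow_of_pos (weight_pos hc w)]

theorem sum_ediam_piece_rpow {c : Fin k → ℝ} (hc : ∀ i, 0 < c i)
    (hf : ∀ i x y, dist (f i x) (f i y) = c i * dist x y) {s : ℝ} (hs : 0 ≤ s)
    (𝒜 : Finset (List (Fin k))) :
    ∑ w ∈ 𝒜, Metric.ediam (piece f K w) ^ s =
      ENNReal.ofReal (∑ w ∈ 𝒜, weight (fun i => c i ^ s) w) * Metric.ediam K ^ s := by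
  rw [ENNReal.ofReal_sum_of_nonneg fun w _ =>
    weight_nonneg (fun i => Real.rpow_nonneg (hc i).le s) w, Finset.sum_mul]
  exact Finset.sum_congr rfl fun w _ => ediam_piece_rpow hc hf hs w

theorem tendsto_ofReal_pow_mul {q : ℝ} (hq : 0 ≤ q) (hq1 : q < 1) {D : ℝ≥0∞} (hD : D ≠ ⊤) :
    Tendsto (fun m : ℕ => ENNReal.ofReal (q ^ m) * D) atTop (𝓝 0) := by
  have h := ENNReal.tendsto_ofReal (tendsto_pow_atTop_nhds_zero_of_lt_one hq hq1)
  simpa using ENNReal.Tendsto.mul_const h (Or.inr hD)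

theorem H4_eq_zero {c : Fin k → ℝ} (hc : ∀ i, 0 < c i)
    (hf : ∀ i x y, dist (f i x) (f i y) = c i * dist x y) (hD : Metric.ediam K ≠ ⊤)
    {s : ℝ} (hs : 0 ≤ s) {B : Finset (List (Fin k))} (hB : ∀ w ∈ B, 1 ≤ w.length)
    (hcov : K ⊆ ⋃ w ∈ B, piece f K w) (hlt : ∑ w ∈ B, weight (fun i => c i ^ s) w < 1) :
    H4 f K s = 0 := by
  have hp : ∀ i, 0 ≤ c i ^ s := fun i => Real.rpow_nonneg (hc i).le s
  refine le_antisymm (iSup_le fun n => ?_) bot_le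
  refine ge_of_tendsto (tendsto_ofReal_pow_mul (Finset.sum_nonneg fun w _ => weight_nonneg hp w)
    hlt (ENNReal.rpow_ne_top_of_nonneg hs hD)) ((eventually_ge_atTop n).mono fun m hm => ?_)
  obtain ⟨𝒜, hlen, hA, hsum⟩ := exists_cover_pow hp hB hcov m
  refine (iInf₂_le_of_le 𝒜 (fun w hw => hm.trans (hlen w hw)) (iInf_le _ hA)).trans ?_
  refine (sum_ediam_piece_rpow hc hf hs 𝒜).trans_le ?_
  gcongr

theorem H3_sum {c : Fin k → ℝ} (hc : ∀ i, 0 < c i)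
    (hf : ∀ i x y, dist (f i x) (f i y) = c i * dist x y) {s : ℝ} (hs : 0 ≤ s) (l : ℕ) :
    ∑ w : Fin l → Fin k, Metric.ediam (piece f K (List.ofFn w)) ^ s =
      ENNReal.ofReal ((∑ i, c i ^ s) ^ l) * Metric.ediam K ^ s := by
  rw [← sum_words l fun w => Metric.ediam (piece f K w) ^ s, sum_ediam_piece_rpow hc hf hs,
    sum_weight_words]

theorem H3_eq_zero {c : Fin k → ℝ} (hc : ∀ i, 0 < c i)
    (hf : ∀ i x y, dist (f i x) (f i y) = c i * dist x y) (hD : Metric.ediam K ≠ ⊤)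
    {s : ℝ} (hs : 0 ≤ s) (hlt : ∑ i, c i ^ s < 1) : H3 f K s = 0 := by
  refine le_antisymm (iSup_le fun n => ?_) bot_le
  refine ge_of_tendsto (tendsto_ofReal_pow_mul
    (Finset.sum_nonneg fun i _ => Real.rpow_nonneg (hc i).le s) hlt
    (ENNReal.rpow_ne_top_of_nonneg hs hD)) ((eventually_ge_atTop n).mono fun l hl => ?_)
  exact (iInf₂_le l hl).trans (H3_sum hc hf hs l).le

theorem H3_ne_zero {c : Fin k → ℝ} (hc : ∀ i, 0 < c i)
    (hf : ∀ i x y, dist (f i x) (f i y) = c i * dist x y) (hD0 : Metric.ediam K ≠ 0)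
    (hD : Metric.ediam K ≠ ⊤) {s : ℝ} (hs : 0 ≤ s) (hge : 1 ≤ ∑ i, c i ^ s) :
    H3 f K s ≠ 0 := by
  have hpos : 0 < Metric.ediam K ^ s := ENNReal.rpow_pos (pos_iff_ne_zero.2 hD0) hD
  refine (hpos.trans_le (le_iSup_of_le 0 (le_iInf₂ fun l _ => ?_))).ne'
  refine le_trans ?_ (H3_sum hc hf hs l).ge
  exact le_mul_of_one_le_left bot_le (by simpa using one_le_pow₀ hge)

theorem Irred.H4_ne_zero (hirr : Irred f K) (hK : K = ⋃ i, f i '' K) {c : Fin k → ℝ}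
    (hc : ∀ i, c i ∈ Set.Ioo (0 : ℝ) 1)
    (hf : ∀ i x y, dist (f i x) (f i y) = c i * dist x y) (hD0 : Metric.ediam K ≠ 0)
    (hD : Metric.ediam K ≠ ⊤) {α s : ℝ} (hαsum : ∑ i, c i ^ α = 1) (hs : 0 ≤ s)
    (hsα : s ≤ α) : H4 f K s ≠ 0 := by
  have hc0 : ∀ i, 0 < c i := fun i => (hc i).1
  have hpos : 0 < Metric.ediam K ^ s := ENNReal.rpow_pos (pos_iff_ne_zero.2 hD0) hD
  refine (hpos.trans_le (le_iSup_of_le 0 (le_iInf₂ fun 𝒜 _ => le_iInf fun hA => ?_))).ne'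
  refine le_trans ?_ (sum_ediam_piece_rpow hc0 hf hs 𝒜).ge
  refine le_mul_of_one_le_left bot_le (ENNReal.one_le_ofReal.2 ?_)
  have hone := one_le_sum_weight (fun i => Real.rpow_nonneg (hc0 i).le α) hαsum 𝒜
    (𝒜.sup List.length) fun w hw =>
      hirr.exists_prefix hK hA fun a ha => hw ▸ Finset.le_sup (f := List.length) ha
  refine hone.trans (Finset.sum_le_sum fun w _ => ?_)
  refine List.prod_map_le_prod_map₀ _ _ (fun i _ => Real.rpow_nonneg (hc0 i).le α) fun i _ => ?_
  exact Real.rpow_le_rpow_of_exponent_ge (hc0 i) (hc i).2.le hsα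

theorem Irred.ediam_ne_zero (hirr : Irred f K) (hk : 2 ≤ k) (hKne : K.Nonempty)
    (hK : K = ⋃ i, f i '' K) : Metric.ediam K ≠ 0 := by
  intro h
  have hsub : K.Subsingleton := Metric.ediam_eq_zero_iff.1 h
  let i : Fin k := ⟨0, by omega⟩
  let j : Fin k := ⟨1, by omega⟩
  refine hirr [i] fun x hx => Set.mem_iUnion₂.2 ⟨[j], ⟨rfl, by simp [i, j]⟩, ?_⟩
  obtain ⟨y, hy⟩ : (piece f K [j]).Nonempty := hKne.image _
  rwa [hsub (piece_subset hK.ge _ hx) (piece_subset hK.ge _ hy)]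

/-- A reducible structure admits efficient covers with exponent below the similarity
dimension. -/
theorem exists_H4_eq_zero_of_not_irred (hirr : ¬ Irred f K) (hKne : K.Nonempty)
    (hK : K = ⋃ i, f i '' K) {c : Fin k → ℝ} (hc : ∀ i, 0 < c i)
    (hf : ∀ i x y, dist (f i x) (f i y) = c i * dist x y)
    (hD : Metric.ediam K ≠ ⊤) {α : ℝ} (hα : 0 < α) (hαsum : ∑ i, c i ^ α = 1) :
    ∃ s, 0 ≤ s ∧ s < α ∧ H4 f K s = 0 := by
  simp only [Irred, not_forall, not_not] at hirr
  obtain ⟨w, hw⟩ := hirr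
  have hlen : 1 ≤ w.length := by
    by_contra! h0
    obtain rfl : w = [] := List.length_eq_zero_iff.1 (by omega)
    obtain ⟨x, hx⟩ := hKne
    obtain ⟨v, ⟨hv, hne⟩, -⟩ := Set.mem_iUnion₂.1 (hw ⟨x, hx, rfl⟩)
    exact hne (List.length_eq_zero_iff.1 hv)
  have hcov : K ⊆ ⋃ v ∈ (words k w.length).erase w, piece f K v := by
    intro x hx
    obtain ⟨v, hv, hxv⟩ := exists_mem_piece hK.le w.length hx
    by_cases hvw : v = w
    · subst hvw
      obtain ⟨u, ⟨hu, hne⟩, hxu⟩ := Set.mem_iUnion₂.1 (hw hxv)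
      exact Set.mem_iUnion₂.2 ⟨u, Finset.mem_erase.2 ⟨hne, mem_words.2 hu⟩, hxu⟩
    · exact Set.mem_iUnion₂.2 ⟨v, Finset.mem_erase.2 ⟨hvw, mem_words.2 hv⟩, hxv⟩
  have hα1 : ∑ v ∈ (words k w.length).erase w, weight (fun i => c i ^ α) v < 1 := by
    have h := Finset.add_sum_erase _ (weight fun i => c i ^ α)
      (mem_words.2 rfl : w ∈ words k w.length)
    rw [sum_weight_words, hαsum, one_pow] at h
    have := weight_pos (fun i => Real.rpow_pos_of_pos (hc i) α) w
    linarith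
  have hcont : Continuous fun s : ℝ =>
      ∑ v ∈ (words k w.length).erase w, weight (fun i => c i ^ s) v := by
    simp only [weight_rpow fun i => (hc i).le]
    exact continuous_finsetSum _ fun v _ =>
      Real.continuous_const_rpow (weight_pos hc v).ne'
  have hev : ∀ᶠ s in 𝓝[<] α,
      ∑ v ∈ (words k w.length).erase w, weight (fun i => c i ^ s) v < 1 :=
    (hcont.continuousAt.eventually_lt continuousAt_const hα1).filter_mono nhdsWithin_le_nhds
  obtain ⟨s, hs1, hs0, hsα⟩ := (hev.and (Ioo_mem_nhdsLT hα)).exists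
  refine ⟨s, hs0.le, hsα, H4_eq_zero hc hf hD hs0.le (fun v hv => ?_) hcov hs1⟩
  rwa [mem_words.1 (Finset.mem_of_mem_erase hv)]

end Dimensions

theorem sInf_vanishing_eq {α : ℝ} (hα : 0 ≤ α) {H : ℝ → ℝ≥0∞} (hgt : ∀ s, α < s → H s = 0)
    (hle : ∀ s, 0 ≤ s → s ≤ α → H s ≠ 0) : sInf {s : ℝ | 0 ≤ s ∧ H s = 0} = α := by
  have hset : {s : ℝ | 0 ≤ s ∧ H s = 0} = Set.Ioi α := by
    ext s
    refine ⟨fun ⟨hs, h0⟩ => ?_, fun hs => ⟨hα.trans (le_of_lt hs), hgt s hs⟩⟩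
    by_contra h
    exact hle s hs (not_lt.1 h) h0
  rw [hset, csInf_Ioi]

theorem stmt_6 {X : Type*} [MetricSpace X] [CompleteSpace X]
    {k : ℕ} (hk : 2 ≤ k) (f : Fin k → X → X) (c : Fin k → ℝ)
    (hc : ∀ i, c i ∈ Set.Ioo (0 : ℝ) 1)
    (hf : ∀ i x y, dist (f i x) (f i y) = c i * dist x y)
    (K : Set X) (hKne : K.Nonempty) (hKcp : IsCompact K)
    (hK : K = ⋃ i, f i '' K)
    (α : ℝ) (hα : 0 < α) (hαsum : ∑ i, c i ^ α = 1) :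
    Irred f K ↔ (dim4 f K = α ∧ dim3 f K = α) := by
  have hc0 : ∀ i, 0 < c i := fun i => (hc i).1
  have hD : Metric.ediam K ≠ ⊤ := hKcp.isBounded.ediam_ne_top
  constructor
  · intro hirr
    have hD0 := hirr.ediam_ne_zero hk hKne hK
    have : Nonempty (Fin k) := ⟨⟨0, by omega⟩⟩
    have hlt : ∀ s, α < s → ∑ i, c i ^ s < 1 := fun s hs => hαsum ▸
      Finset.sum_lt_sum_of_nonempty Finset.univ_nonempty fun i _ =>
        Real.rpow_lt_rpow_of_exponent_gt (hc0 i) (hc i).2 hs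
    have hge : ∀ s ≤ α, 1 ≤ ∑ i, c i ^ s := fun s hs => hαsum ▸
      Finset.sum_le_sum fun i _ => Real.rpow_le_rpow_of_exponent_ge (hc0 i) (hc i).2.le hs
    refine ⟨sInf_vanishing_eq hα.le (fun s hs => ?_) fun s hs hsα =>
        hirr.H4_ne_zero hK hc hf hD0 hD hαsum hs hsα,
      sInf_vanishing_eq hα.le (fun s hs => H3_eq_zero hc0 hf hD (hα.trans hs).le (hlt s hs))
        fun s hs hsα => H3_ne_zero hc0 hf hD0 hD hs (hge s hsα)⟩
    refine H4_eq_zero hc0 hf hD (hα.trans hs).le (B := words k 1)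
      (fun w hw => (mem_words.1 hw).ge) (fun x hx => ?_) ?_
    · obtain ⟨w, hw, hxw⟩ := exists_mem_piece hK.le 1 hx
      exact Set.mem_iUnion₂.2 ⟨w, mem_words.2 hw, hxw⟩
    · simpa [sum_weight_words] using hlt s hs
  · rintro ⟨h4, -⟩
    by_contra hirr
    obtain ⟨s, hs, hsα, h0⟩ :=
      exists_H4_eq_zero_of_not_irred hirr hKne hK hc0 hf hD hα hαsum
    have hle : dim4 f K ≤ s := csInf_le ⟨0, fun _ h => h.1⟩ ⟨hs, h0⟩
    linarith

end IFSMoran
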